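/- Let m, σ, s be real with 0 < m < 1/2 and 0 < σ < 1, and let x_L ∈ [0,1], x_R ∈ [0,1). Set ρ = σ(1−x_L)/(1−σx_L) (the sender's posterior that L's candidate is moderate after not observing L's advertisement). Define U_truth = ρ·[x_L(m−s) + (1−x_L)(−1+m+s)] + (1−ρ)·(−1+m+s) and U_hide = ρ·[(1−x_R(1−x_L))(m−s) + x_R(1−x_L)(−1+m+s)] + (1−ρ)·[x_R(−1+m+s) + (1−x_R)(m/2−s)]. Then U_truth ≥ U_hide if and only if s ≥ 1/2 − (m/4)·(1−σ)/(σ(1−x_L)² + 1−σ). -/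

import Mathlib

/-- Incentive-compatibility for a sender informed only about the receiver's
less-favoured party: with posterior `ρ = σ(1−x_L)/(1−σ x_L)`, truthful
revelation dominates hiding iff `s ≥ 1/2 − (m/4)(1−σ)/(σ(1−x_L)² + 1−σ)`. -/
theorem partially_informed_sender_IC (m σ s xL xR : ℝ)
    (hm : 0 < m) (hm' : m < 1/2)
    (hσ : 0 < σ) (hσ' : σ < 1)
    (hxL : 0 ≤ xL) (hxL' : xL ≤ 1)
    (hxR : 0 ≤ xR) (hxR' : xR < 1) :
    let ρ : ℝ := σ * (1 - xL) / (1 - σ * xL)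
    let Utruth : ℝ :=
      ρ * (xL * (m - s) + (1 - xL) * (-1 + m + s)) + (1 - ρ) * (-1 + m + s)
    let Uhide : ℝ :=
      ρ * ((1 - xR * (1 - xL)) * (m - s) + xR * (1 - xL) * (-1 + m + s)) +
        (1 - ρ) * (xR * (-1 + m + s) + (1 - xR) * (m/2 - s))
    (Utruth ≥ Uhide ↔ s ≥ 1/2 - (m/4) * (1 - σ) / (σ * (1 - xL)^2 + 1 - σ)) := by
  have hD : 0 < 1 - σ * xL := by nlinarith
  have hK : 0 < σ * (1 - xL)^2 + 1 - σ := by nlinarith [mul_nonneg hσ.le (sq_nonneg (1 - xL))]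
  intro ρ Utruth Uhide
  have hgap : Utruth - Uhide =
      2 * (1 - xR) * (σ * (1 - xL)^2 + 1 - σ) / (1 - σ * xL) *
        (s - (1/2 - (m/4) * (1 - σ) / (σ * (1 - xL)^2 + 1 - σ))) := by
    simp only [Utruth, Uhide, ρ]
    field_simp
    ring
  have hpos : 0 < 2 * (1 - xR) * (σ * (1 - xL)^2 + 1 - σ) / (1 - σ * xL) :=
    div_pos (mul_pos (by linarith) hK) hD
  rw [ge_iff_le, ge_iff_le, ← sub_nonneg, hgap, mul_nonneg_iff_of_pos_left hpos, sub_nonneg]
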